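/- For every positive integer n and every positive integer k, the number of 132-avoiding permutations of length n whose unique longest increasing subsequence has length k equals the number of Dyck paths of semilength n that have a unique peak of maximum height, with that maximum peak height equal to k. (A Dyck path of semilength n is a lattice path from (0,0) to (2n,0) using n up-steps (1,1) and n down-steps (1,−1) that never goes below the x-axis; a peak is a lattice point immediately preceded by an up-step and immediately followed by a down-step, and its height is its y-coordinate.) -/

import Mathlib

/-- `s` is the index set of an increasing subsequence of the word `f`. -/
def IsIncSubseq {n : ℕ} {α : Type*} [Preorder α] (f : Fin n → α) (s : Finset (Fin n)) : Prop :=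
  ∀ i ∈ s, ∀ j ∈ s, i < j → f i < f j

/-- `f` has a unique longest increasing subsequence. -/
def HasULIS {n : ℕ} {α : Type*} [Preorder α] (f : Fin n → α) : Prop :=
  ∃! s : Finset (Fin n), IsIncSubseq f s ∧
    ∀ t : Finset (Fin n), IsIncSubseq f t → t.card ≤ s.card

/-- `p` contains the pattern `q`. -/
def Contains {k n : ℕ} (q : Equiv.Perm (Fin k)) (p : Equiv.Perm (Fin n)) : Prop :=
  ∃ f : Fin k → Fin n, StrictMono f ∧ ∀ a b : Fin k, p (f a) < p (f b) ↔ q a < q b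

/-- `p` avoids the pattern `q`. -/
def Avoids {k n : ℕ} (q : Equiv.Perm (Fin k)) (p : Equiv.Perm (Fin n)) : Prop :=
  ¬ Contains q p

def pattern321 : Equiv.Perm (Fin 3) := ⟨![2,1,0], ![2,1,0], by decide, by decide⟩
def pattern231 : Equiv.Perm (Fin 3) := ⟨![1,2,0], ![2,0,1], by decide, by decide⟩
def pattern132 : Equiv.Perm (Fin 3) := ⟨![0,2,1], ![0,2,1], by decide, by decide⟩
def pattern123 : Equiv.Perm (Fin 3) := Equiv.refl (Fin 3)

/-- the number of `q`-avoiding permutations of length `n` with a unique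
longest increasing subsequence. -/
noncomputable def uNum {k : ℕ} (q : Equiv.Perm (Fin k)) (n : ℕ) : ℕ :=
  Nat.card {p : Equiv.Perm (Fin n) // Avoids q p ∧ HasULIS ⇑p}

/-- the number of `q`-avoiding involutions of length `n` with a unique
longest increasing subsequence. -/
noncomputable def iNum {k : ℕ} (q : Equiv.Perm (Fin k)) (n : ℕ) : ℕ :=
  Nat.card {p : Equiv.Perm (Fin n) // p⁻¹ = p ∧ Avoids q p ∧ HasULIS ⇑p}

/-- A permutation is indecomposable if it cannot be cut into a (nonempty) prefix and
a (nonempty) suffix so that every entry of the prefix is smaller than every entry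
of the suffix. -/
def Indecomposable {m : ℕ} (w : Equiv.Perm (Fin m)) : Prop :=
  ¬ ∃ j : ℕ, 1 ≤ j ∧ j < m ∧ ∀ a b : Fin m, (a : ℕ) < j → j ≤ (b : ℕ) → w a < w b

/-- `f` has a unique longest increasing subsequence, of length `k`. -/
def HasULISOfLength {n : ℕ} {α : Type*} [Preorder α] (f : Fin n → α) (k : ℕ) : Prop :=
  ∃! s : Finset (Fin n), IsIncSubseq f s ∧
    (∀ t : Finset (Fin n), IsIncSubseq f t → t.card ≤ s.card) ∧ s.card = k

/-- A Dyck path of semilength `n`, recorded by its sequence of heights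
`h 0, h 1, …, h (2n)`: it starts and ends at height `0`, never goes below `0`,
and each step changes the height by `±1`. -/
def IsDyckPath (n : ℕ) (h : Fin (2 * n + 1) → ℤ) : Prop :=
  h ⟨0, by omega⟩ = 0 ∧ h ⟨2 * n, by omega⟩ = 0 ∧ (∀ i, 0 ≤ h i) ∧
  ∀ i : ℕ, ∀ hi : i < 2 * n,
    h ⟨i + 1, by omega⟩ = h ⟨i, by omega⟩ + 1 ∨
    h ⟨i + 1, by omega⟩ = h ⟨i, by omega⟩ - 1

/-- The point at index `i` of the path is a peak: it is immediately preceded by an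
up-step and immediately followed by a down-step. -/
def IsPeak (n : ℕ) (h : Fin (2 * n + 1) → ℤ) (i : Fin (2 * n + 1)) : Prop :=
  ∃ hi : 0 < (i : ℕ) ∧ (i : ℕ) < 2 * n,
    h ⟨(i : ℕ) - 1, by omega⟩ + 1 = h i ∧ h ⟨(i : ℕ) + 1, by omega⟩ + 1 = h i

/-- The path `h` has a unique peak of maximum height, and that maximum peak height
is `k`. -/
def UniqueMaxPeakHeight (n : ℕ) (h : Fin (2 * n + 1) → ℤ) (k : ℕ) : Prop :=
  (∀ i, IsPeak n h i → h i ≤ (k : ℤ)) ∧ (∃! i, IsPeak n h i ∧ h i = (k : ℤ))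

open Finset

theorem avoids_pattern132_iff {n : ℕ} (p : Equiv.Perm (Fin n)) :
    Avoids pattern132 p ↔ ∀ a b c, a < b → b < c → p a < p c → p b < p c := by
  unfold Avoids Contains
  constructor
  · intro h a b c hab hbc hac
    by_contra hcb
    have hcb : p c < p b :=
      lt_of_le_of_ne (not_lt.mp hcb) fun e => hbc.ne' (p.injective e)
    refine h ⟨![a, b, c], ?_, ?_⟩
    · rw [Fin.strictMono_iff_lt_succ]
      intro i
      fin_cases i
      · exact hab
      · exact hbc
    · have hab' := hac.trans hcb
      intro x y
      fin_cases x <;> fin_cases y <;>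
        simp [pattern132, hac, hcb, hab', hac.le, hcb.le, hab'.le]
  · rintro h ⟨f, hf, hp⟩
    have h1 := h (f 0) (f 1) (f 2) (hf (by decide)) (hf (by decide))
      ((hp 0 2).2 (by simp [pattern132]))
    exact absurd ((hp 1 2).1 h1) (by simp [pattern132])

/-- The positions weakly to the right of `j` whose entries are at least `p j`. -/
def upperRight {n : ℕ} (p : Equiv.Perm (Fin n)) (j : Fin n) : Finset (Fin n) :=
  {i | j ≤ i ∧ p j ≤ p i}

theorem mem_upperRight {n : ℕ} {p : Equiv.Perm (Fin n)} {i j : Fin n} :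
    i ∈ upperRight p j ↔ j ≤ i ∧ p j ≤ p i := by
  simp [upperRight]

theorem self_mem_upperRight {n : ℕ} (p : Equiv.Perm (Fin n)) (j : Fin n) :
    j ∈ upperRight p j := mem_upperRight.2 ⟨le_rfl, le_rfl⟩

theorem upperRight_injective {n : ℕ} (p : Equiv.Perm (Fin n)) :
    Function.Injective (upperRight p) := by
  intro i j h
  have hi := self_mem_upperRight p i
  have hj := self_mem_upperRight p j
  rw [h] at hi
  rw [← h] at hj
  exact le_antisymm (mem_upperRight.1 hj).1 (mem_upperRight.1 hi).1

theorem one_le_card_upperRight {n : ℕ} (p : Equiv.Perm (Fin n)) (j : Fin n) :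
    1 ≤ #(upperRight p j) := card_pos.2 ⟨j, self_mem_upperRight p j⟩

theorem card_upperRight_le {n : ℕ} (p : Equiv.Perm (Fin n)) (j : Fin n) :
    #(upperRight p j) ≤ n - j := by
  rw [← Fin.card_Ici]
  exact card_le_card fun i hi => mem_Ici.2 (mem_upperRight.1 hi).1

theorem card_upperRight_injective {n : ℕ} :
    Function.Injective fun (p : Equiv.Perm (Fin n)) j => #(upperRight p j) := by
  intro p q h
  ext1 j
  induction j using WellFoundedLT.induction with
  | ind j ih =>
  have key : ∀ p : Equiv.Perm (Fin n), #(upperRight p j) =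
      #{v | (∀ i < j, p i ≠ v) ∧ p j ≤ v} := by
    intro p
    rw [← card_map p.toEmbedding]
    congr 1
    ext v
    simp only [mem_map, mem_upperRight, mem_filter, mem_univ, true_and, Equiv.coe_toEmbedding]
    constructor
    · rintro ⟨i, ⟨hji, hp⟩, rfl⟩
      exact ⟨fun l hl e => (hl.trans_le hji).ne (p.injective e), hp⟩
    · rintro ⟨hv, hp⟩
      refine ⟨p.symm v, ⟨?_, by simpa using hp⟩, by simp⟩
      by_contra hlt
      exact hv _ (not_le.1 hlt) (by simp)
  have avail : ∀ v, (∀ i < j, p i ≠ v) ↔ ∀ i < j, q i ≠ v := fun v =>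
    forall₂_congr fun i hi => by rw [ih i hi]
  have fresh : ∀ p : Equiv.Perm (Fin n), ∀ i < j, p i ≠ p j :=
    fun p i hi e => hi.ne (p.injective e)
  have hcard := congrFun h j
  simp only [key] at hcard
  rcases lt_trichotomy (p j) (q j) with hlt | heq | hlt
  · refine absurd hcard (ne_of_gt (card_lt_card ⟨?_, ?_⟩))
    · intro v
      simp only [mem_filter, mem_univ, true_and, avail]
      exact fun hv => ⟨hv.1, hlt.le.trans hv.2⟩
    · intro hs
      have := hs (mem_filter.2 ⟨mem_univ _, fresh p, le_rfl⟩)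
      exact absurd (mem_filter.1 this).2.2 (not_le.2 hlt)
  · exact heq
  · refine absurd hcard (ne_of_lt (card_lt_card ⟨?_, ?_⟩))
    · intro v
      simp only [mem_filter, mem_univ, true_and, avail]
      exact fun hv => ⟨hv.1, hlt.le.trans hv.2⟩
    · intro hs
      have := hs (mem_filter.2 ⟨mem_univ _, fresh q, le_rfl⟩)
      exact absurd (mem_filter.1 this).2.2 (not_le.2 hlt)

/-- Every sequence within the bounds of a Lehmer code is the code of a permutation. -/
theorem exists_perm_card_upperRight {n : ℕ} (c : Fin n → ℕ) (h1 : ∀ j, 1 ≤ c j)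
    (h2 : ∀ j, c j ≤ n - j) : ∃ p : Equiv.Perm (Fin n), ∀ j, #(upperRight p j) = c j := by
  let F : Equiv.Perm (Fin n) → (j : Fin n) → Fin (n - j) := fun p j =>
    ⟨#(upperRight p j) - 1, by
      have := one_le_card_upperRight p j
      have := card_upperRight_le p j
      omega⟩
  have hF : Function.Bijective F := by
    rw [Fintype.bijective_iff_injective_and_card]
    constructor
    · intro p q h
      apply card_upperRight_injective
      funext j
      have := congrArg Fin.val (congrFun h j)
      have := one_le_card_upperRight p j
      have := one_le_card_upperRight q j
      simp only [F] at *
      omega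
    · rw [Fintype.card_perm, Fintype.card_pi]
      simp only [Fintype.card_fin]
      rw [Fin.prod_univ_eq_prod_range (fun j => n - j) n, ← Nat.descFactorial_eq_prod_range,
        Nat.descFactorial_self]
  obtain ⟨p, hp⟩ := hF.2 fun j => ⟨c j - 1, by have := h1 j; have := h2 j; omega⟩
  refine ⟨p, fun j => ?_⟩
  have := congrArg Fin.val (congrFun hp j)
  have := one_le_card_upperRight p j
  have := h1 j
  simp only [F] at *
  omega

theorem avoids_pattern132_iff_erase_subset {n : ℕ} (p : Equiv.Perm (Fin n)) :
    Avoids pattern132 p ↔ ∀ i j : Fin n, (i : ℕ) + 1 = j →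
      (upperRight p i).erase i ⊆ upperRight p j := by
  rw [avoids_pattern132_iff]
  constructor
  · intro h i j hij l hl
    simp only [mem_erase, mem_upperRight] at hl ⊢
    obtain ⟨hne, hil, hp⟩ := hl
    have hjl : j ≤ l := by
      rw [Fin.le_def] at *
      have : (l : ℕ) ≠ i := fun e => hne (Fin.ext e)
      omega
    refine ⟨hjl, ?_⟩
    rcases hjl.eq_or_lt with rfl | hjl
    · exact le_rfl
    · exact (h i j l (Fin.lt_def.2 (by omega)) hjl
        (lt_of_le_of_ne hp fun e => hne (p.injective e.symm))).le
  · intro h a b c hab hbc hac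
    have main : ∀ m : ℕ, ∀ a : Fin n, (a : ℕ) + m + 1 = b → p a < p c → p b < p c := by
      intro m
      induction m with
      | zero =>
        intro a ha hac
        have := h a b (by omega) (mem_erase.2 ⟨(hbc.trans' (Fin.lt_def.2 (by omega))).ne',
          mem_upperRight.2 ⟨(hbc.trans' (Fin.lt_def.2 (by omega))).le, hac.le⟩⟩)
        exact lt_of_le_of_ne (mem_upperRight.1 this).2 fun e => hbc.ne (p.injective e)
      | succ m ih =>
        intro a ha hac
        have hlt : (a : ℕ) + 1 < n := by omega
        have hac' : a < c := hbc.trans' (Fin.lt_def.2 (by omega))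
        have := h a ⟨a + 1, hlt⟩ rfl (mem_erase.2 ⟨hac'.ne',
          mem_upperRight.2 ⟨hac'.le, hac.le⟩⟩)
        refine ih ⟨a + 1, hlt⟩ (by simp only; omega)
          (lt_of_le_of_ne (mem_upperRight.1 this).2 fun e => ?_)
        have := congrArg Fin.val (p.injective e)
        have := Fin.lt_def.1 hbc
        simp only at *
        omega
    have := Fin.lt_def.1 hab
    exact main (b - a - 1) a (by omega) hac

theorem avoids_pattern132_iff_card {n : ℕ} (p : Equiv.Perm (Fin n)) :
    Avoids pattern132 p ↔ ∀ i j : Fin n, (i : ℕ) + 1 = j →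
      #(upperRight p i) ≤ #(upperRight p j) + 1 := by
  rw [avoids_pattern132_iff_erase_subset]
  refine forall₃_congr fun i j hij => ?_
  rw [← Nat.sub_le_iff_le_add, ← card_erase_of_mem (self_mem_upperRight p i)]
  refine ⟨card_le_card, fun hc => ?_⟩
  have hlt : i < j := Fin.lt_def.2 (by omega)
  rcases le_total (p i) (p j) with hp | hp
  · refine (eq_of_subset_of_card_le (fun l hl => ?_) hc).symm.subset
    rw [mem_upperRight] at hl
    exact mem_erase.2 ⟨(hlt.trans_le hl.1).ne', mem_upperRight.2
      ⟨hlt.le.trans hl.1, hp.trans hl.2⟩⟩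
  · intro l hl
    rw [mem_erase, mem_upperRight] at hl
    refine mem_upperRight.2 ⟨?_, hp.trans hl.2.2⟩
    have : (l : ℕ) ≠ i := fun e => hl.1 (Fin.ext e)
    have := Fin.le_def.1 hl.2.1
    exact Fin.le_def.2 (by omega)

theorem isIncSubseq_upperRight {n : ℕ} {p : Equiv.Perm (Fin n)} (hp : Avoids pattern132 p)
    (j : Fin n) : IsIncSubseq p (upperRight p j) := by
  rw [avoids_pattern132_iff] at hp
  intro a ha b hb hab
  rw [mem_upperRight] at ha hb
  rcases ha.1.eq_or_lt with rfl | hja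
  · exact lt_of_le_of_ne hb.2 fun e => hab.ne (p.injective e)
  · exact hp j a b hja hab
      (lt_of_le_of_ne hb.2 fun e => (hja.trans hab).ne (p.injective e))

theorem IsIncSubseq.subset_upperRight_min' {n : ℕ} {p : Equiv.Perm (Fin n)}
    {s : Finset (Fin n)} (hs : IsIncSubseq p s) (hne : s.Nonempty) :
    s ⊆ upperRight p (s.min' hne) := by
  intro i hi
  have hle := s.min'_le i hi
  refine mem_upperRight.2 ⟨hle, ?_⟩
  rcases hle.eq_or_lt with h | h
  · rw [← h]
  · exact (hs _ (s.min'_mem hne) _ hi h).le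

theorem hasULISOfLength_iff {n k : ℕ} (hk : 1 ≤ k) {p : Equiv.Perm (Fin n)}
    (hp : Avoids pattern132 p) :
    HasULISOfLength p k ↔
      (∀ j, #(upperRight p j) ≤ k) ∧ ∃! j, #(upperRight p j) = k := by
  constructor
  · rintro ⟨s, ⟨hinc, hmax, rfl⟩, huniq⟩
    have hne : s.Nonempty := card_pos.1 hk
    have hle : ∀ j, #(upperRight p j) ≤ #s := fun j => hmax _ (isIncSubseq_upperRight hp j)
    have hs : s = upperRight p (s.min' hne) :=
      eq_of_subset_of_card_le (hinc.subset_upperRight_min' hne) (hle _)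
    refine ⟨hle, s.min' hne, congrArg card hs.symm, fun i hi => upperRight_injective p ?_⟩
    rw [← hs]
    exact huniq _ ⟨isIncSubseq_upperRight hp i, fun t ht => (hmax t ht).trans hi.ge, hi⟩
  · rintro ⟨hle, j, hj, huniq⟩
    refine ⟨upperRight p j, ⟨isIncSubseq_upperRight hp j, fun t ht => ?_, hj⟩, ?_⟩
    · rcases t.eq_empty_or_nonempty with rfl | hne
      · simp
      · exact (card_le_card (ht.subset_upperRight_min' hne)).trans ((hle _).trans hj.ge)
    · rintro t ⟨ht, -, hc⟩
      have hne : t.Nonempty := card_pos.1 (by omega)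
      have hs : t = upperRight p (t.min' hne) :=
        eq_of_subset_of_card_le (ht.subset_upperRight_min' hne) ((hle _).trans hc.ge)
      rw [← huniq (t.min' hne) (by dsimp only; rw [← hs]; exact hc)]
      exact hs

/-- `d` lists the indices of the down-steps of a Dyck path of semilength `n`. -/
structure IsDownSeq {n : ℕ} (d : Fin n → ℕ) : Prop where
  strictMono : StrictMono d
  le (j : Fin n) : 2 * (j : ℕ) + 1 ≤ d j
  lt (j : Fin n) : d j < 2 * n

/-- Among the starting points of the down-steps listed by `d`, the maximum height is `k`, and it
is attained once. -/
def UniqueMaxHeight {n : ℕ} (d : Fin n → ℕ) (k : ℕ) : Prop :=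
  (∀ j, d j ≤ k + 2 * (j : ℕ)) ∧ ∃! j, d j = k + 2 * (j : ℕ)

theorem Fin.strictMono_of_lt_of_succ_eq {n : ℕ} {d : Fin n → ℕ}
    (h : ∀ i j : Fin n, (i : ℕ) + 1 = j → d i < d j) : StrictMono d := by
  cases n with
  | zero => exact fun i => i.elim0
  | succ n => exact Fin.strictMono_iff_lt_succ.2 fun i => h _ _ (by simp)

theorem StrictMono.fin_add_le {n : ℕ} {d : Fin n → ℕ} (hd : StrictMono d) {i j : Fin n}
    (h : i ≤ j) : d i + (j - i : ℕ) ≤ d j := by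
  have main : ∀ m : ℕ, ∀ j : Fin n, (i : ℕ) + m = j → d i + m ≤ d j := by
    intro m
    induction m with
    | zero =>
      intro j hj
      rw [show i = j from Fin.ext hj]
      simp
    | succ m ih =>
      intro j hj
      have h1 := ih ⟨i + m, by omega⟩ rfl
      have h2 : d ⟨i + m, by omega⟩ < d j := hd (Fin.lt_def.2 (by simp only; omega))
      omega
  have := Fin.le_def.1 h
  exact main _ j (by omega)

theorem card_avoids_hasULISOfLength (n k : ℕ) (hk : 1 ≤ k) :
    Nat.card {p : Equiv.Perm (Fin n) // Avoids pattern132 p ∧ HasULISOfLength ⇑p k} =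
      Nat.card {d : Fin n → ℕ // IsDownSeq d ∧ UniqueMaxHeight d k} := by
  have stat : ∀ p : Equiv.Perm (Fin n), Avoids pattern132 p → (HasULISOfLength p k ↔
      UniqueMaxHeight (fun j => #(upperRight p j) + 2 * (j : ℕ)) k) := fun p hp => by
    simp [hasULISOfLength_iff hk hp, UniqueMaxHeight]
  refine Nat.card_eq_of_bijective
    (fun p => ⟨fun j => #(upperRight p.1 j) + 2 * (j : ℕ), ⟨?_, ?_, ?_⟩,
      (stat _ p.2.1).1 p.2.2⟩) ⟨?_, ?_⟩
  · refine Fin.strictMono_of_lt_of_succ_eq fun i j hij => ?_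
    have := (avoids_pattern132_iff_card p.1).1 p.2.1 i j hij
    omega
  · intro j
    have := one_le_card_upperRight p.1 j
    omega
  · intro j
    have := card_upperRight_le p.1 j
    omega
  · intro p q h
    apply Subtype.ext
    apply card_upperRight_injective
    funext j
    have := congrFun (congrArg Subtype.val h) j
    simpa using this
  · rintro ⟨d, hd, hmax⟩
    obtain ⟨p, hp⟩ := exists_perm_card_upperRight (fun j => d j - 2 * (j : ℕ))
      (fun j => by have := hd.le j; omega) (fun j => by
        have h0 := j.2
        have h1 := hd.strictMono.fin_add_le (i := j) (j := ⟨n - 1, by omega⟩)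
          (Fin.le_def.2 (by simp only; omega))
        have h2 := hd.lt ⟨n - 1, by omega⟩
        simp only at *
        omega)
    have hpd : (fun j => #(upperRight p j) + 2 * (j : ℕ)) = d := by
      funext j
      have := hd.le j
      rw [hp]
      omega
    have hav : Avoids pattern132 p := (avoids_pattern132_iff_card p).2 fun i j hij => by
      have h1 : d i < d j := hd.strictMono (Fin.lt_def.2 (by omega))
      have := hd.le i
      rw [hp, hp]
      omega
    exact ⟨⟨p, hav, (stat p hav).2 (hpd ▸ hmax)⟩, Subtype.ext hpd⟩

/-- The height at abscissa `i` of the path whose down-steps are listed by `d`. -/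
def height {n : ℕ} (d : Fin n → ℕ) (i : ℕ) : ℤ := i - 2 * (#{j | d j < i} : ℤ)

theorem height_apply {n : ℕ} {d : Fin n → ℕ} (hd : StrictMono d) (j : Fin n) :
    height d (d j) = d j - 2 * ((j : ℕ) : ℤ) := by
  have : #{l | d l < d j} = (j : ℕ) := by
    simp only [hd.lt_iff_lt]
    rw [← Fin.card_Iio]
    congr 1
    ext
    simp
  rw [height, this]

theorem height_apply_succ {n : ℕ} {d : Fin n → ℕ} (hd : StrictMono d) (j : Fin n) :
    height d (d j + 1) = height d (d j) - 1 := by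
  have : #{l | d l < d j + 1} = (j : ℕ) + 1 := by
    simp only [Nat.lt_succ_iff, hd.le_iff_le]
    rw [← Fin.card_Iic]
    congr 1
    ext
    simp
  rw [height_apply hd, height, this]
  push_cast
  ring

theorem height_succ_of_notMem {n : ℕ} {d : Fin n → ℕ} {i : ℕ} (hi : ∀ j, d j ≠ i) :
    height d (i + 1) = height d i + 1 := by
  have : ∀ l, d l < i + 1 ↔ d l < i := fun l => by have := hi l; omega
  simp only [height, this]
  push_cast
  ring

theorem height_succ_eq_sub_one_iff {n : ℕ} {d : Fin n → ℕ} (hd : StrictMono d) (i : ℕ) :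
    height d (i + 1) = height d i - 1 ↔ i ∈ Set.range d := by
  constructor
  · intro h
    by_contra hi
    have := height_succ_of_notMem (d := d) (i := i) fun j e => hi ⟨j, e⟩
    omega
  · rintro ⟨j, rfl⟩
    exact height_apply_succ hd j

theorem height_nonneg {n : ℕ} {d : Fin n → ℕ} (hd : IsDownSeq d) (i : ℕ) : 0 ≤ height d i := by
  rw [height]
  by_contra! hneg
  have hcard : #{l | d l < i} ≤ n := (card_le_univ _).trans (by simp)
  have hpos : 0 < #{l | d l < i} := by omega
  set m := #{l | d l < i} with hm
  have hlt : d ⟨m - 1, by omega⟩ < i := by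
    by_contra! hle
    have : m ≤ #(Iio (⟨m - 1, by omega⟩ : Fin n)) := by
      refine card_le_card fun l hl => ?_
      rw [mem_filter] at hl
      rw [mem_Iio]
      exact hd.strictMono.lt_iff_lt.1 (hl.2.trans_le hle)
    rw [Fin.card_Iio] at this
    simp only at this
    omega
  have := hd.le ⟨m - 1, by omega⟩
  simp only at this
  omega

theorem isDyckPath_height {n : ℕ} {d : Fin n → ℕ} (hd : IsDownSeq d) :
    IsDyckPath n fun i => height d i := by
  refine ⟨by simp [height], ?_, fun i => height_nonneg hd i, fun i _ => ?_⟩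
  · have : ∀ j, d j < 2 * n := hd.lt
    simp [height, this]
  · by_cases hi : i ∈ Set.range d
    · exact Or.inr ((height_succ_eq_sub_one_iff hd.strictMono i).2 hi)
    · exact Or.inl (height_succ_of_notMem fun j e => hi ⟨j, e⟩)

theorem uniqueMaxPeakHeight_height_iff {n : ℕ} {d : Fin n → ℕ} (hd : IsDownSeq d) (k : ℕ) :
    UniqueMaxPeakHeight n (fun i => height d i) k ↔ UniqueMaxHeight d k := by
  have apex : ∀ i, IsPeak n (fun i => height d i) i → ∃ j, (i : ℕ) = d j := by
    rintro i ⟨_, _, h⟩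
    obtain ⟨j, hj⟩ := (height_succ_eq_sub_one_iff hd.strictMono (i : ℕ)).1
      (by simp only at h; omega)
    exact ⟨j, hj.symm⟩
  have lt (j : Fin n) : d j < 2 * n + 1 := (hd.lt j).trans (Nat.lt_succ_self _)
  have peak_or : ∀ j, IsPeak n (fun i => height d i) ⟨d j, lt j⟩ ∨
      ∃ l < j, d l + 1 = d j := by
    intro j
    have hpos := hd.le j
    by_cases h : ∃ l, d l = d j - 1
    · obtain ⟨l, hl⟩ := h
      exact Or.inr ⟨l, hd.strictMono.lt_iff_lt.1 (by omega), by omega⟩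
    · push Not at h
      refine Or.inl ⟨⟨by simp only; omega, hd.lt j⟩, ?_, ?_⟩
      · have := height_succ_of_notMem h
        rw [Nat.sub_add_cancel (by omega)] at this
        exact this.symm
      · have := height_apply_succ hd.strictMono j
        simp only
        omega
  have step : ∀ l j, l < j → d l + 1 = d j → d l ≤ k + 2 * (l : ℕ) →
      d j < k + 2 * (j : ℕ) := by
    intro l j hlj h hl
    have := Fin.lt_def.1 hlj
    omega
  have happly := height_apply hd.strictMono
  constructor
  · rintro ⟨hle, i, ⟨hi, hik⟩, huniq⟩
    have hle' : ∀ j, d j ≤ k + 2 * (j : ℕ) := by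
      intro j
      induction j using WellFoundedLT.induction with
      | ind j ih =>
      rcases peak_or j with h | ⟨l, hl, h⟩
      · have := hle _ h
        simp only [happly] at this
        omega
      · exact (step l j hl h (ih l hl)).le
    obtain ⟨j, hj⟩ := apex i hi
    refine ⟨hle', j, ?_, fun m hm => ?_⟩
    · have := happly j
      simp only [hj] at hik
      simp only
      omega
    · rcases peak_or m with h | ⟨l, hl, h⟩
      · have := huniq _ ⟨h, by
          simp only [happly]
          simp only at hm
          omega⟩
        have := congrArg Fin.val this
        exact hd.strictMono.injective (this.trans hj)
      · exact absurd hm (step l m hl h (hle' l)).ne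
  · rintro ⟨hle, j, hj, huniq⟩
    refine ⟨fun i hi => ?_, ⟨d j, lt j⟩, ⟨?_, ?_⟩, ?_⟩
    · obtain ⟨m, hm⟩ := apex i hi
      have := hle m
      simp only [hm, happly]
      omega
    · rcases peak_or j with h | ⟨l, hl, h⟩
      · exact h
      · exact absurd hj (step l j hl h (hle l)).ne
    · simp only [happly]
      omega
    · rintro i ⟨hi, hik⟩
      obtain ⟨m, hm⟩ := apex i hi
      simp only [hm, happly] at hik
      have := huniq m (by simp only; omega)
      exact Fin.ext (by rw [hm, this])

theorem IsDyckPath.exists_isDownSeq {n : ℕ} {h : Fin (2 * n + 1) → ℤ} (hh : IsDyckPath n h) :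
    ∃ d : Fin n → ℕ, IsDownSeq d ∧ (fun i : Fin (2 * n + 1) => height d i) = h := by
  obtain ⟨h0, h1, hnonneg, hstep⟩ := hh
  let S : Finset ℕ := {i ∈ range (2 * n) | ∃ hi : i < 2 * n,
    h ⟨i + 1, by omega⟩ = h ⟨i, by omega⟩ - 1}
  have hS : ∀ i (hi : i < 2 * n), i ∈ S ↔
      h ⟨i + 1, by omega⟩ = h ⟨i, by omega⟩ - 1 := by
    intro i hi
    simp [S, hi]
  have hcount : ∀ i (hi : i < 2 * n + 1), h ⟨i, hi⟩ = i - 2 * (#{x ∈ S | x < i} : ℤ) := by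
    intro i
    induction i with
    | zero => intro hi; simpa using h0
    | succ i ih =>
      intro hi
      have hprev := ih (by omega)
      by_cases hmem : i ∈ S
      · have : S.filter (· < i + 1) = insert i (S.filter (· < i)) := by
          ext x
          simp only [mem_filter, mem_insert]
          constructor
          · rintro ⟨hx, hlt⟩
            rcases Nat.lt_succ_iff_lt_or_eq.1 hlt with h | h
            · exact Or.inr ⟨hx, h⟩
            · exact Or.inl h
          · rintro (rfl | ⟨hx, hlt⟩)
            · exact ⟨hmem, Nat.lt_succ_self _⟩
            · exact ⟨hx, by omega⟩
        rw [this, card_insert_of_notMem (by simp), (hS i (by omega)).1 hmem, hprev]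
        push_cast
        ring
      · have : S.filter (· < i + 1) = S.filter (· < i) := by
          refine filter_congr fun x hx => ?_
          have : x ≠ i := fun e => hmem (e ▸ hx)
          omega
        rw [this, ((hstep i (by omega)).resolve_right fun e => hmem ((hS i (by omega)).2 e)),
          hprev]
        push_cast
        ring
  have hSlt : ∀ x ∈ S, x < 2 * n := fun x hx => mem_range.1 (mem_filter.1 hx).1
  have hcard : #S = n := by
    have := hcount (2 * n) (by omega)
    rw [h1, filter_true_of_mem hSlt] at this
    push_cast at this
    omega
  let d : Fin n → ℕ := S.orderEmbOfFin hcard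
  have hd : StrictMono d := (S.orderEmbOfFin hcard).strictMono
  have hmem : ∀ j, d j ∈ S := fun j => S.orderEmbOfFin_mem hcard j
  have hheight : ∀ i (hi : i < 2 * n + 1), height d i = h ⟨i, hi⟩ := by
    intro i hi
    rw [hcount, height]
    congr 3
    refine card_bij (fun j _ => d j) (fun j hj => ?_) (fun _ _ _ _ e => hd.injective e)
      fun x hx => ?_
    · exact mem_filter.2 ⟨hmem j, (mem_filter.1 hj).2⟩
    · obtain ⟨hx, hlt⟩ := mem_filter.1 hx
      have : x ∈ Set.range (S.orderEmbOfFin hcard) := by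
        rw [range_orderEmbOfFin]
        exact hx
      obtain ⟨j, rfl⟩ := this
      exact ⟨j, mem_filter.2 ⟨mem_univ _, hlt⟩, rfl⟩
  have hlt : ∀ j, d j < 2 * n := fun j => hSlt _ (hmem j)
  refine ⟨d, ⟨hd, fun j => ?_, hlt⟩, funext fun i => hheight i i.2⟩
  have hpos := hnonneg ⟨d j + 1, by have := hlt j; omega⟩
  rw [← hheight, height_apply_succ hd, height_apply hd] at hpos
  omega

theorem card_isDyckPath_uniqueMaxPeakHeight (n k : ℕ) :
    Nat.card {d : Fin n → ℕ // IsDownSeq d ∧ UniqueMaxHeight d k} =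
      Nat.card {h : Fin (2 * n + 1) → ℤ //
        IsDyckPath n h ∧ UniqueMaxPeakHeight n h k} := by
  refine Nat.card_eq_of_bijective
    (fun d => ⟨fun i => height d.1 i, isDyckPath_height d.2.1,
      (uniqueMaxPeakHeight_height_iff d.2.1 k).2 d.2.2⟩) ⟨?_, ?_⟩
  · rintro ⟨d, hd, _⟩ ⟨e, he, _⟩ h
    have hval : ∀ i < 2 * n + 1, height d i = height e i := fun i hi =>
      congrFun (congrArg Subtype.val h) ⟨i, hi⟩
    have hrange : ∀ i < 2 * n, i ∈ Set.range d ↔ i ∈ Set.range e := fun i hi => by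
      rw [← height_succ_eq_sub_one_iff hd.strictMono, ← height_succ_eq_sub_one_iff he.strictMono,
        hval i (by omega), hval (i + 1) (by omega)]
    refine Subtype.ext ((hd.strictMono.range_inj he.strictMono).1 (Set.Subset.antisymm ?_ ?_))
    · rintro _ ⟨j, rfl⟩
      exact (hrange _ (hd.lt j)).1 ⟨j, rfl⟩
    · rintro _ ⟨j, rfl⟩
      exact (hrange _ (he.lt j)).2 ⟨j, rfl⟩
  · rintro ⟨h, hh, hmax⟩
    obtain ⟨d, hd, rfl⟩ := hh.exists_isDownSeq
    exact ⟨⟨d, hd, (uniqueMaxPeakHeight_height_iff hd k).1 hmax⟩, rfl⟩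

/-- For all `n, k ≥ 1`, the number of 132-avoiding permutations of length `n` whose
unique longest increasing subsequence has length `k` equals the number of Dyck paths
of semilength `n` with a unique peak of maximum height, that height being `k`. -/
theorem u132_length_k_eq_dyck (n k : ℕ) (hn : 1 ≤ n) (hk : 1 ≤ k) :
    Nat.card {p : Equiv.Perm (Fin n) // Avoids pattern132 p ∧ HasULISOfLength ⇑p k}
      = Nat.card {h : Fin (2 * n + 1) → ℤ //
          IsDyckPath n h ∧ UniqueMaxPeakHeight n h k} :=
  (card_avoids_hasULISOfLength n k hk).trans (card_isDyckPath_uniqueMaxPeakHeight n k)
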